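/- Let E be a real inner product space, let f₁,…,f_m : E → ℝ be differentiable functions whose gradients ∇fᵢ are all L-Lipschitz, and let f := (1/m)∑_{i=1}^m fᵢ. Suppose that for every x ∈ E, (1/m)∑_{i=1}^m ‖∇fᵢ(x) − ∇f(x)‖² ≤ σ_g². Then for every x ∈ E and every choice of perturbations δ₁,…,δ_m, δ ∈ E with ‖δᵢ‖ ≤ ρ for all i and ‖δ‖ ≤ ρ, one has (1/m)∑_{i=1}^m ‖∇fᵢ(x + δᵢ) − ∇f(x + δ)‖² ≤ 3σ_g² + 6L²ρ². -/

import Mathlib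

/-- Lemma D.2 of the paper, bounded global variance of the
SAM-perturbed gradients, in averaged form. Let `f₁,…,f_m : E → ℝ` be
differentiable with `L`-Lipschitz gradients, `f := (1/m)∑ᵢ fᵢ`, and suppose
`(1/m)∑ᵢ ‖∇fᵢ(x) - ∇f(x)‖² ≤ σ_g²` for all `x`. Then for every `x` and all
perturbations `δᵢ, δ` with `‖δᵢ‖ ≤ ρ` and `‖δ‖ ≤ ρ`,
`(1/m)∑ᵢ ‖∇fᵢ(x + δᵢ) - ∇f(x + δ)‖² ≤ 3σ_g² + 6L²ρ²`. -/
theorem perturbed_global_variance_bound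
    {E : Type*} [NormedAddCommGroup E] [InnerProductSpace ℝ E] [CompleteSpace E]
    (m : ℕ) (hm : 1 ≤ m) (f : Fin m → E → ℝ) (F : E → ℝ)
    (L σg ρ : ℝ) (hL : 0 ≤ L) (hσg : 0 ≤ σg) (hρ : 0 ≤ ρ)
    (hdiff : ∀ i, Differentiable ℝ (f i))
    (hlip : ∀ i, ∀ x y : E,
      ‖gradient (f i) x - gradient (f i) y‖ ≤ L * ‖x - y‖)
    (hF : F = fun x => (1 / (m : ℝ)) * ∑ i, f i x)
    (hvar : ∀ x : E,
      (1 / (m : ℝ)) * ∑ i, ‖gradient (f i) x - gradient F x‖ ^ 2 ≤ σg ^ 2) :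
    ∀ (x : E) (δ : Fin m → E) (δ₀ : E),
      (∀ i, ‖δ i‖ ≤ ρ) → ‖δ₀‖ ≤ ρ →
      (1 / (m : ℝ)) * ∑ i, ‖gradient (f i) (x + δ i) - gradient F (x + δ₀)‖ ^ 2 ≤
        3 * σg ^ 2 + 6 * L ^ 2 * ρ ^ 2 := by
  intro x δ δ₀ hδ hδ₀
  have hm0 : (0 : ℝ) < m := by exact_mod_cast hm
  have hgrad : ∀ y, gradient F y = (1 / (m : ℝ)) • ∑ i, gradient (f i) y := by
    intro y
    have h1 : HasFDerivAt F ((1 / (m : ℝ)) • ∑ i, fderiv ℝ (f i) y) y := by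
      rw [hF]
      exact (HasFDerivAt.fun_sum fun i _ => (hdiff i y).hasFDerivAt).const_mul _
    unfold gradient
    rw [h1.fderiv, map_smulₛₗ, map_sum]
    simp
  have hFlip : ‖gradient F x - gradient F (x + δ₀)‖ ≤ L * ρ := by
    rw [hgrad, hgrad, ← smul_sub, ← Finset.sum_sub_distrib, norm_smul,
      Real.norm_of_nonneg (by positivity)]
    have h2 : ‖∑ i, (gradient (f i) x - gradient (f i) (x + δ₀))‖ ≤ ∑ _i : Fin m, L * ρ := by
      refine norm_sum_le_of_le _ fun i _ => (hlip i _ _).trans ?_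
      have : x - (x + δ₀) = -δ₀ := by abel
      rw [this, norm_neg]
      gcongr
    simp only [Finset.sum_const, Finset.card_univ, Fintype.card_fin, nsmul_eq_mul] at h2
    calc _ ≤ (1 / (m : ℝ)) * (m * (L * ρ)) := by gcongr
      _ = L * ρ := by field_simp
  have hterm : ∀ i, ‖gradient (f i) (x + δ i) - gradient F (x + δ₀)‖ ^ 2 ≤
      3 * ‖gradient (f i) x - gradient F x‖ ^ 2 + 6 * L ^ 2 * ρ ^ 2 := by
    intro i
    have h1 : ‖gradient (f i) (x + δ i) - gradient (f i) x‖ ≤ L * ρ := by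
      refine (hlip i _ _).trans ?_
      rw [add_sub_cancel_left]
      have := hδ i
      gcongr
    have h3 : ‖gradient (f i) (x + δ i) - gradient F (x + δ₀)‖ ≤
        L * ρ + ‖gradient (f i) x - gradient F x‖ + L * ρ := by
      have e : gradient (f i) (x + δ i) - gradient F (x + δ₀) =
        (gradient (f i) (x + δ i) - gradient (f i) x) + (gradient (f i) x - gradient F x)
          + (gradient F x - gradient F (x + δ₀)) := by abel
      rw [e]
      exact norm_add₃_le.trans (by gcongr)
    have h4 := pow_le_pow_left₀ (norm_nonneg _) h3 2
    nlinarith [sq_nonneg (‖gradient (f i) x - gradient F x‖ - L * ρ)]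
  have hs := Finset.sum_le_sum fun i (_ : i ∈ (Finset.univ : Finset (Fin m))) => hterm i
  rw [Finset.sum_add_distrib, ← Finset.mul_sum] at hs
  simp only [Finset.sum_const, Finset.card_univ, Fintype.card_fin, nsmul_eq_mul] at hs
  have hv := hvar x
  calc _ ≤ (1 / (m : ℝ)) * (3 * ∑ i, ‖gradient (f i) x - gradient F x‖ ^ 2
        + m * (6 * L ^ 2 * ρ ^ 2)) := by gcongr
    _ = 3 * ((1 / (m : ℝ)) * ∑ i, ‖gradient (f i) x - gradient F x‖ ^ 2)
        + 6 * L ^ 2 * ρ ^ 2 := by field_simp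
    _ ≤ _ := by linarith
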